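/- arXiv:0710.3227 — 3 statements merged into one kernel-verified Lean document; each statement's English description precedes it below -/
import Mathlib

section
/- Let $N \ge 3$, let $A : \mathbb{R}^N \to \mathbb{R}^N$ be continuous, $x_0 \in \mathbb{R}^N$, $s > 0$, and let $\beta > 0$ and $\varphi : \mathbb{R}^N \to [0,1]$ be smooth with $\varphi(y) = 1$ for $|y| \le \beta$ and $\varphi(y) = 0$ for $|y| \ge 2\beta$. Let $U : \mathbb{R}^N \to \mathbb{C}$ be continuously differentiable with $|U(y)| + |\nabla U(y)| \le C_0 e^{-c_0|y|}$ for some $C_0, c_0 > 0$ and all $y$. Define $w_\varepsilon(z) = e^{i \langle A(x_0), z \rangle}\, \varphi(\varepsilon z)\, U(z/s)$. Then $\lim_{\varepsilon \to 0^+} \int_{\mathbb{R}^N} \big| -i \nabla w_\varepsilon(z) - A(\varepsilon z + x_0) w_\varepsilon(z) \big|^2 \, dz = s^{N-2} \int_{\mathbb{R}^N} |\nabla U(y)|^2 \, dy$. -/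
open MeasureTheory Filter

noncomputable section

/-- partial derivative of a complex-valued `u` in the `j`-th coordinate direction -/
def pd {N : ℕ} (u : EuclideanSpace ℝ (Fin N) → ℂ) (j : Fin N)
    (y : EuclideanSpace ℝ (Fin N)) : ℂ :=
  fderiv ℝ u y (EuclideanSpace.single j (1 : ℝ))

/-- `|∇u(y)|² = ∑ j |∂ⱼu(y)|²` -/
def gradSq {N : ℕ} (u : EuclideanSpace ℝ (Fin N) → ℂ)
    (y : EuclideanSpace ℝ (Fin N)) : ℝ :=
  ∑ j, ‖pd u j y‖ ^ 2

/-- `|-i∇u(y) - B(y)u(y)|² = ∑ j |-i∂ⱼu(y) - Bⱼ(y)u(y)|²` -/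
def magSq {N : ℕ} (B : EuclideanSpace ℝ (Fin N) → EuclideanSpace ℝ (Fin N))
    (u : EuclideanSpace ℝ (Fin N) → ℂ) (y : EuclideanSpace ℝ (Fin N)) : ℝ :=
  ∑ j, ‖(-Complex.I) * pd u j y - (B y j : ℂ) * u y‖ ^ 2

/-- A phase times a rescaled cut-off times a rescaled profile. -/
def phaseCutoff {N : ℕ} (a : EuclideanSpace ℝ (Fin N)) (φ : EuclideanSpace ℝ (Fin N) → ℝ)
    (U : EuclideanSpace ℝ (Fin N) → ℂ) (s ε : ℝ) (z : EuclideanSpace ℝ (Fin N)) : ℂ :=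
  Complex.exp (Complex.I * (∑ j, a j * z j : ℝ)) * (φ (ε • z) : ℂ) * U (s⁻¹ • z)

/-- The `j`-th magnetic derivative of `phaseCutoff` with the phase and a factor `-i` removed. -/
def magneticRemainder {N : ℕ} (a b : EuclideanSpace ℝ (Fin N))
    (φ : EuclideanSpace ℝ (Fin N) → ℝ) (U : EuclideanSpace ℝ (Fin N) → ℂ) (s ε : ℝ) (j : Fin N)
    (z : EuclideanSpace ℝ (Fin N)) : ℂ :=
  Complex.I * ((φ (ε • z) * (a j - b j) : ℝ) : ℂ) * U (s⁻¹ • z)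
    + ((ε * fderiv ℝ φ (ε • z) (EuclideanSpace.single j 1) : ℝ) : ℂ) * U (s⁻¹ • z)
    + ((φ (ε • z) * s⁻¹ : ℝ) : ℂ) * pd U j (s⁻¹ • z)

lemma pd_phaseCutoff {N : ℕ} (a : EuclideanSpace ℝ (Fin N)) {φ : EuclideanSpace ℝ (Fin N) → ℝ}
    (hφ : Differentiable ℝ φ) {U : EuclideanSpace ℝ (Fin N) → ℂ} (hU : Differentiable ℝ U)
    (s ε : ℝ) (j : Fin N) (z : EuclideanSpace ℝ (Fin N)) :
    pd (phaseCutoff a φ U s ε) j z =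
      Complex.exp (Complex.I * (∑ j, a j * z j : ℝ)) *
        magneticRemainder a 0 φ U s ε j z := by
  have hphase : HasFDerivAt (fun z : EuclideanSpace ℝ (Fin N) => ∑ j, a j * z j)
      (∑ j, a j • (EuclideanSpace.proj j : EuclideanSpace ℝ (Fin N) →L[ℝ] ℝ)) z :=
    HasFDerivAt.fun_sum fun j _ =>
      (EuclideanSpace.proj j : EuclideanSpace ℝ (Fin N) →L[ℝ] ℝ).hasFDerivAt.const_mul (a j)
  have hexp := ((Complex.ofRealCLM.hasFDerivAt.comp z hphase).const_mul Complex.I).cexp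
  have hcut := Complex.ofRealCLM.hasFDerivAt.comp z
    ((hφ (ε • z)).hasFDerivAt.comp z ((hasFDerivAt_id z).const_smul ε))
  have hprof := (hU (s⁻¹ • z)).hasFDerivAt.comp z ((hasFDerivAt_id z).const_smul s⁻¹)
  have h := (hexp.mul hcut).mul hprof
  have hfd : fderiv ℝ (phaseCutoff a φ U s ε) z = _ := h.fderiv
  rw [pd, hfd, magneticRemainder]
  simp [pd, ← Complex.ofReal_sum, ← Complex.ofReal_mul]
  push_cast
  ring

lemma magSq_phaseCutoff {N : ℕ} (B : EuclideanSpace ℝ (Fin N) → EuclideanSpace ℝ (Fin N))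
    (a : EuclideanSpace ℝ (Fin N)) {φ : EuclideanSpace ℝ (Fin N) → ℝ}
    (hφ : Differentiable ℝ φ) {U : EuclideanSpace ℝ (Fin N) → ℂ} (hU : Differentiable ℝ U)
    (s ε : ℝ) (z : EuclideanSpace ℝ (Fin N)) :
    magSq B (phaseCutoff a φ U s ε) z = ∑ j, ‖magneticRemainder a (B z) φ U s ε j z‖ ^ 2 := by
  refine Finset.sum_congr rfl fun j _ => ?_
  have hfactor : (-Complex.I) * pd (phaseCutoff a φ U s ε) j z
        - (B z j : ℂ) * phaseCutoff a φ U s ε z =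
      (-Complex.I * Complex.exp (Complex.I * (∑ j, a j * z j : ℝ))) *
        magneticRemainder a (B z) φ U s ε j z := by
    rw [pd_phaseCutoff a hφ hU, phaseCutoff, magneticRemainder, magneticRemainder]
    simp only [PiLp.zero_apply]
    push_cast
    linear_combination (Complex.exp (Complex.I * (∑ j, (a j : ℂ) * (z j : ℂ)))
      * (B z j : ℂ) * (φ (ε • z) : ℂ) * U (s⁻¹ • z)) * (-Complex.I_sq)
  have hunit : ‖Complex.exp (Complex.I * (∑ j, a j * z j : ℝ))‖ = 1 := by
    rw [mul_comm]
    exact Complex.norm_exp_ofReal_mul_I _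
  rw [hfactor, norm_mul, norm_mul, hunit]
  simp

lemma norm_pd_le {N : ℕ} (u : EuclideanSpace ℝ (Fin N) → ℂ) (j : Fin N)
    (y : EuclideanSpace ℝ (Fin N)) : ‖pd u j y‖ ≤ ‖fderiv ℝ u y‖ := by
  simpa [pd] using (fderiv ℝ u y).le_opNorm (EuclideanSpace.single j (1 : ℝ))

lemma continuous_pd {N : ℕ} {u : EuclideanSpace ℝ (Fin N) → ℂ} (hu : ContDiff ℝ 1 u)
    (j : Fin N) : Continuous (pd u j) :=
  (hu.continuous_fderiv one_ne_zero).clm_apply continuous_const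

lemma norm_magneticRemainder_le {N : ℕ} {a b : EuclideanSpace ℝ (Fin N)}
    {φ : EuclideanSpace ℝ (Fin N) → ℝ} {U : EuclideanSpace ℝ (Fin N) → ℂ} {s ε M M' D : ℝ}
    (hs : 0 < s) (hε : 0 ≤ ε) (hε1 : ε ≤ 1) (j : Fin N) (z : EuclideanSpace ℝ (Fin N))
    (hφ01 : φ (ε • z) ∈ Set.Icc (0 : ℝ) 1) (hM : ‖φ (ε • z) • (a - b)‖ ≤ M)
    (hM' : ‖fderiv ℝ φ (ε • z)‖ ≤ M')
    (hD : ‖U (s⁻¹ • z)‖ + ‖fderiv ℝ U (s⁻¹ • z)‖ ≤ D) :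
    ‖magneticRemainder a b φ U s ε j z‖ ≤ (M + M' + s⁻¹) * D := by
  have hUD : ‖U (s⁻¹ • z)‖ ≤ D := by linarith [norm_nonneg (fderiv ℝ U (s⁻¹ • z))]
  have hdUD : ‖pd U j (s⁻¹ • z)‖ ≤ D := by
    linarith [norm_nonneg (U (s⁻¹ • z)), norm_pd_le U j (s⁻¹ • z)]
  have hpot : |φ (ε • z) * (a j - b j)| ≤ M :=
    (PiLp.norm_apply_le (φ (ε • z) • (a - b)) j).trans hM
  have hcut : |ε * fderiv ℝ φ (ε • z) (EuclideanSpace.single j 1)| ≤ M' := by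
    have h : |fderiv ℝ φ (ε • z) (EuclideanSpace.single j 1)| ≤ M' := by
      simpa using ((fderiv ℝ φ (ε • z)).le_opNorm (EuclideanSpace.single j (1 : ℝ))).trans
        (by simpa using hM')
    rw [abs_mul, abs_of_nonneg hε]
    exact (mul_le_of_le_one_left (abs_nonneg _) hε1).trans h
  have hprof : |φ (ε • z) * s⁻¹| ≤ s⁻¹ := by
    rw [abs_of_nonneg (mul_nonneg hφ01.1 (inv_nonneg.2 hs.le))]
    exact mul_le_of_le_one_left (inv_nonneg.2 hs.le) hφ01.2
  have hM0 : 0 ≤ M := (abs_nonneg _).trans hpot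
  have hM0' : 0 ≤ M' := (abs_nonneg _).trans hcut
  rw [magneticRemainder, add_mul, add_mul]
  refine norm_add₃_le.trans ?_
  simp only [norm_mul, Complex.norm_I, one_mul, Complex.norm_real, Real.norm_eq_abs]
  rw [← abs_mul, ← abs_mul, ← abs_mul]
  gcongr

lemma integrable_exp_neg_mul_norm {E : Type*} [NormedAddCommGroup E] [NormedSpace ℝ E]
    [FiniteDimensional ℝ E] [Nontrivial E] [MeasurableSpace E] [BorelSpace E] (μ : Measure E)
    [μ.IsAddHaarMeasure] {c : ℝ} (hc : 0 < c) :
    Integrable (fun x : E => Real.exp (-c * ‖x‖)) μ := by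
  rw [integrable_fun_norm_addHaar μ (f := fun r : ℝ => Real.exp (-c * r))]
  refine (integrableOn_rpow_mul_exp_neg_mul_rpow (s := (Module.finrank ℝ E - 1 : ℕ)) (p := 1)
    (b := c) (neg_one_lt_zero.trans_le (Nat.cast_nonneg _)) one_pos hc).congr_fun ?_
    measurableSet_Ioi
  intro r _
  simp

theorem stmt8 {N : ℕ} (hN : 3 ≤ N)
    (A : EuclideanSpace ℝ (Fin N) → EuclideanSpace ℝ (Fin N)) (hA : Continuous A)
    (x₀ : EuclideanSpace ℝ (Fin N)) (s : ℝ) (hs : 0 < s)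
    (β : ℝ) (hβ : 0 < β) (φ : EuclideanSpace ℝ (Fin N) → ℝ)
    (hφ : ContDiff ℝ (⊤ : ℕ∞) φ) (hφ01 : ∀ y, φ y ∈ Set.Icc (0:ℝ) 1)
    (hφ1 : ∀ y : EuclideanSpace ℝ (Fin N), ‖y‖ ≤ β → φ y = 1)
    (hφ0 : ∀ y : EuclideanSpace ℝ (Fin N), 2 * β ≤ ‖y‖ → φ y = 0)
    (U : EuclideanSpace ℝ (Fin N) → ℂ) (hU : ContDiff ℝ 1 U)
    (C₀ c₀ : ℝ) (hC₀ : 0 < C₀) (hc₀ : 0 < c₀)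
    (hdecay : ∀ y, ‖U y‖ + ‖fderiv ℝ U y‖ ≤ C₀ * Real.exp (-c₀ * ‖y‖))
    (w : ℝ → EuclideanSpace ℝ (Fin N) → ℂ)
    (hw : w = fun ε z => Complex.exp (Complex.I * (∑ j, A x₀ j * z j : ℝ)) *
      (φ (ε • z) : ℂ) * U (s⁻¹ • z)) :
    Filter.Tendsto
      (fun ε => ∫ z, magSq (fun z' => A (ε • z' + x₀)) (w ε) z)
      (nhdsWithin 0 (Set.Ioi 0))
      (nhds ((s : ℝ) ^ (N - 2) * ∫ y, gradSq U y)) := by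
  have : Nonempty (Fin N) := ⟨⟨0, by omega⟩⟩
  have hφC1 : ContDiff ℝ 1 φ := hφ.of_le (by exact_mod_cast le_top)
  have hφd : Differentiable ℝ φ := hφC1.differentiable one_ne_zero
  have hφ' : Continuous (fderiv ℝ φ) := hφC1.continuous_fderiv one_ne_zero
  have hUd : Differentiable ℝ U := hU.differentiable one_ne_zero
  have hφsupp : HasCompactSupport φ := HasCompactSupport.intro
    (isCompact_closedBall (0 : EuclideanSpace ℝ (Fin N)) (2 * β)) fun y hy =>
      hφ0 y (by simpa using (not_le.1 (by simpa using hy : ¬ ‖y‖ ≤ 2 * β)).le)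
  obtain ⟨M, hM⟩ := (hφsupp.smul_right
    (f' := fun y => A x₀ - A (y + x₀))).exists_bound_of_continuous (hφd.continuous.smul (by fun_prop))
  obtain ⟨M', hM'⟩ := (hφsupp.fderiv (𝕜 := ℝ)).exists_bound_of_continuous hφ'
  have hwε : ∀ ε, w ε = phaseCutoff (A x₀) φ U s ε := fun ε => by rw [hw]; rfl
  simp only [hwε, magSq_phaseCutoff _ _ hφd hUd]
  have hpt : ∀ (z : EuclideanSpace ℝ (Fin N)), Tendsto
      (fun ε => ∑ j, ‖magneticRemainder (A x₀) (A (ε • z + x₀)) φ U s ε j z‖ ^ 2)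
      (nhdsWithin 0 (Set.Ioi 0)) (nhds ((s⁻¹) ^ 2 * gradSq U (s⁻¹ • z))) := by
    intro z
    have hcont : Continuous
        (fun ε : ℝ => ∑ j, ‖magneticRemainder (A x₀) (A (ε • z + x₀)) φ U s ε j z‖ ^ 2) := by
      have hφc := hφd.continuous
      unfold magneticRemainder
      fun_prop
    have hzero : ∑ j, ‖magneticRemainder (A x₀) (A ((0 : ℝ) • z + x₀)) φ U s 0 j z‖ ^ 2 =
        (s⁻¹) ^ 2 * gradSq U (s⁻¹ • z) := by
      simp [magneticRemainder, gradSq, hφ1 0 (by simpa using hβ.le), mul_pow, Finset.mul_sum]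
    rw [← hzero]
    exact (hcont.tendsto 0).mono_left nhdsWithin_le_nhds
  have hlim : (s : ℝ) ^ (N - 2) * ∫ y, gradSq U y =
      ∫ z : EuclideanSpace ℝ (Fin N), (s⁻¹) ^ 2 * gradSq U (s⁻¹ • z) := by
    rw [integral_const_mul, Measure.integral_comp_inv_smul_of_nonneg _ _ hs.le,
      finrank_euclideanSpace_fin, smul_eq_mul, ← mul_assoc, pow_sub₀ _ hs.ne' (by omega),
      inv_pow, mul_comm (s ^ N)]
  rw [hlim]
  refine tendsto_integral_filter_of_dominated_convergence
    (fun z => ∑ _j : Fin N, ((M + M' + s⁻¹) * C₀) ^ 2 * Real.exp (-(2 * c₀ * s⁻¹) * ‖z‖))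
    (Eventually.of_forall fun ε => ?_) ?_ ?_ (Eventually.of_forall hpt)
  · refine Continuous.aestronglyMeasurable ?_
    have hφc := hφd.continuous
    have hUc := hU.continuous
    have hpd := continuous_pd hU
    unfold magneticRemainder
    fun_prop
  · filter_upwards [Ioc_mem_nhdsGT one_pos] with ε hε
    refine Eventually.of_forall fun z => ?_
    rw [Real.norm_of_nonneg (by positivity)]
    refine Finset.sum_le_sum fun j _ => ?_
    have h := norm_magneticRemainder_le hs hε.1.le hε.2 j z (hφ01 _) (hM (ε • z)) (hM' (ε • z))
      (hdecay (s⁻¹ • z))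
    refine (pow_le_pow_left₀ (norm_nonneg _) h 2).trans_eq ?_
    rw [← mul_assoc, mul_pow, ← Real.exp_nat_mul, norm_smul, Real.norm_of_nonneg (by positivity)]
    congr 2
    push_cast
    ring
  · exact integrable_finsetSum _ fun _ _ =>
      (integrable_exp_neg_mul_norm volume (by positivity)).const_mul _

end
end

section
/- Let $N \ge 3$, $a > 0$, let $f : [0,\infty) \to \mathbb{R}$ be continuous with $f(0)=0$ and $F(t) = \int_0^t f(s)\,ds$, and let $u : \mathbb{R}^N \to \mathbb{R}$ be continuously differentiable with $0 < \int_{\mathbb{R}^N}|\nabla u|^2\,dy < \infty$, $\int_{\mathbb{R}^N}|u|^2\,dy < \infty$, and $\int_{\mathbb{R}^N}|F(u^2)|\,dy < \infty$. Define $P(u) = \tfrac{N-2}{2}\int_{\mathbb{R}^N}|\nabla u|^2\,dy + N\int_{\mathbb{R}^N}\big( \tfrac{a}{2}u^2 - F(u^2) \big)\,dy$ and suppose $P(u) < 0$. Then there exists $\theta \in (0,1)$ such that the dilated function $u_\theta(y) = u(y/\theta)$ satisfies $P(u_\theta) = 0$ and $L_a(u_\theta) = \tfrac{\theta^{N-2}}{N}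 \int_{\mathbb{R}^N} |\nabla u|^2\,dy < \tfrac1N \int_{\mathbb{R}^N} |\nabla u|^2\,dy$, where $L_a(v) = \tfrac12 \int_{\mathbb{R}^N}(|\nabla v|^2 + a v^2)\,dy - \int_{\mathbb{R}^N} F(v^2)\,dy$. -/
open MeasureTheory Filter

noncomputable section

/-- partial derivative of a real-valued `u` in the `j`-th coordinate direction -/
def pdR {N : ℕ} (u : EuclideanSpace ℝ (Fin N) → ℝ) (j : Fin N)
    (y : EuclideanSpace ℝ (Fin N)) : ℝ :=
  fderiv ℝ u y (EuclideanSpace.single j (1 : ℝ))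

/-- `|∇u(y)|² = ∑ j (∂ⱼu(y))²` -/
def gradSqR {N : ℕ} (u : EuclideanSpace ℝ (Fin N) → ℝ)
    (y : EuclideanSpace ℝ (Fin N)) : ℝ :=
  ∑ j, (pdR u j y) ^ 2

/-- `F(t) = ∫₀ᵗ f(s) ds` -/
def Fprim (f : ℝ → ℝ) (t : ℝ) : ℝ := ∫ s in (0:ℝ)..t, f s

/-- the Pohozaev functional -/
def Poh {N : ℕ} (a : ℝ) (f : ℝ → ℝ) (u : EuclideanSpace ℝ (Fin N) → ℝ) : ℝ :=
  ((N : ℝ) - 2) / 2 * (∫ y, gradSqR u y)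
    + (N : ℝ) * ∫ y, (a / 2 * (u y) ^ 2 - Fprim f ((u y) ^ 2))

/-- the energy functional -/
def La {N : ℕ} (a : ℝ) (f : ℝ → ℝ) (u : EuclideanSpace ℝ (Fin N) → ℝ) : ℝ :=
  (1/2) * (∫ y, (gradSqR u y + a * (u y) ^ 2)) - ∫ y, Fprim f ((u y) ^ 2)

theorem gradSqR_comp_smul {N : ℕ} (c : ℝ) (u : EuclideanSpace ℝ (Fin N) → ℝ)
    (y : EuclideanSpace ℝ (Fin N)) :
    gradSqR (fun y => u (c • y)) y = c ^ 2 * gradSqR u (c • y) := by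
  simp only [gradSqR, pdR, fderiv_comp_smul, _root_.smul_apply, smul_eq_mul, mul_pow,
    Finset.mul_sum]

theorem integral_comp_inv_smul_euclidean {N : ℕ} (g : EuclideanSpace ℝ (Fin N) → ℝ) {θ : ℝ}
    (hθ : 0 ≤ θ) : ∫ y, g (θ⁻¹ • y) = θ ^ N * ∫ y, g y := by
  simpa using Measure.integral_comp_inv_smul_of_nonneg volume g hθ

theorem integral_gradSqR_dilation {N : ℕ} (hN : 2 ≤ N) (u : EuclideanSpace ℝ (Fin N) → ℝ)
    {θ : ℝ} (hθ : 0 < θ) :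
    ∫ y, gradSqR (fun y => u (θ⁻¹ • y)) y = θ ^ (N - 2) * ∫ y, gradSqR u y := by
  simp only [gradSqR_comp_smul]
  rw [integral_const_mul, integral_comp_inv_smul_euclidean _ hθ.le, ← mul_assoc]
  congr 1
  obtain ⟨k, rfl⟩ := Nat.exists_eq_add_of_le' hN
  rw [Nat.add_sub_cancel]
  field_simp
  ring

theorem Poh_dilation {N : ℕ} (hN : 2 ≤ N) (a : ℝ) (f : ℝ → ℝ)
    (u : EuclideanSpace ℝ (Fin N) → ℝ) {θ : ℝ} (hθ : 0 < θ) :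
    Poh a f (fun y => u (θ⁻¹ • y)) =
      θ ^ (N - 2) * (((N : ℝ) - 2) / 2 * (∫ y, gradSqR u y)
        + N * (θ ^ 2 * ∫ y, (a / 2 * (u y) ^ 2 - Fprim f ((u y) ^ 2)))) := by
  rw [Poh, integral_gradSqR_dilation hN u hθ,
    integral_comp_inv_smul_euclidean (fun y => a / 2 * (u y) ^ 2 - Fprim f ((u y) ^ 2)) hθ.le]
  obtain ⟨k, rfl⟩ := Nat.exists_eq_add_of_le' hN
  rw [Nat.add_sub_cancel]
  ring

theorem La_dilation {N : ℕ} (hN : 2 ≤ N) (a : ℝ) (f : ℝ → ℝ)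
    (u : EuclideanSpace ℝ (Fin N) → ℝ)
    (hgrad : Integrable (fun y => gradSqR u y)) (hL2 : Integrable (fun y => (u y) ^ 2))
    (hF : Integrable (fun y => Fprim f ((u y) ^ 2))) {θ : ℝ} (hθ : 0 < θ) :
    La a f (fun y => u (θ⁻¹ • y)) =
      θ ^ (N - 2) * (1 / 2 * (∫ y, gradSqR u y)
        + θ ^ 2 * ∫ y, (a / 2 * (u y) ^ 2 - Fprim f ((u y) ^ 2))) := by
  have hθ' : θ⁻¹ ≠ 0 := inv_ne_zero hθ.ne'
  have hgrad' : Integrable (fun y => gradSqR (fun y => u (θ⁻¹ • y)) y) := by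
    simp only [gradSqR_comp_smul]
    exact (hgrad.comp_smul hθ').const_mul _
  have hL2' : Integrable (fun y => (u (θ⁻¹ • y)) ^ 2) := hL2.comp_smul hθ'
  rw [La, integral_add hgrad' (hL2'.const_mul a), integral_const_mul,
    integral_gradSqR_dilation hN u hθ,
    integral_comp_inv_smul_euclidean (fun y => (u y) ^ 2) hθ.le,
    integral_comp_inv_smul_euclidean (fun y => Fprim f ((u y) ^ 2)) hθ.le,
    integral_sub (hL2.const_mul _) hF, integral_const_mul]
  obtain ⟨k, rfl⟩ := Nat.exists_eq_add_of_le' hN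
  rw [Nat.add_sub_cancel]
  ring

theorem stmt14 {N : ℕ} (hN : 3 ≤ N) (a : ℝ) (ha : 0 < a)
    (f : ℝ → ℝ) (hfc : ContinuousOn f (Set.Ici 0)) (hf0 : f 0 = 0)
    (u : EuclideanSpace ℝ (Fin N) → ℝ) (hu : ContDiff ℝ 1 u)
    (hgrad : Integrable (fun y => gradSqR u y)) (hgradpos : 0 < ∫ y, gradSqR u y)
    (hL2 : Integrable (fun y => (u y) ^ 2))
    (hF : Integrable (fun y => Fprim f ((u y) ^ 2)))
    (hP : Poh a f u < 0) :
    ∃ θ : ℝ, θ ∈ Set.Ioo (0:ℝ) 1 ∧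
      Poh a f (fun y => u (θ⁻¹ • y)) = 0 ∧
      La a f (fun y => u (θ⁻¹ • y)) = θ ^ (N - 2) / (N : ℝ) * ∫ y, gradSqR u y ∧
      θ ^ (N - 2) / (N : ℝ) * (∫ y, gradSqR u y) < 1 / (N : ℝ) * ∫ y, gradSqR u y := by
  have hN3 : (3 : ℝ) ≤ N := by exact_mod_cast hN
  have hN2 : 2 ≤ N := by omega
  have hNpos : (0 : ℝ) < N := by linarith
  have hPoh := fun θ (hθ : (0 : ℝ) < θ) => Poh_dilation hN2 a f u hθ
  have hLa := fun θ (hθ : (0 : ℝ) < θ) => La_dilation hN2 a f u hgrad hL2 hF hθ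
  rw [Poh] at hP
  set G := ∫ y, gradSqR u y
  set W := ∫ y, (a / 2 * (u y) ^ 2 - Fprim f ((u y) ^ 2))
  have hA : 0 < ((N : ℝ) - 2) / 2 * G := mul_pos (by linarith) hgradpos
  have hNW : 0 < -(N * W) := by linarith
  have hW : W ≠ 0 := by
    rintro h
    simp [h] at hNW
  have hq : 0 < ((N : ℝ) - 2) / 2 * G / -(N * W) := div_pos hA hNW
  set θ := √(((N : ℝ) - 2) / 2 * G / -(N * W))
  have hθ : 0 < θ := Real.sqrt_pos.2 hq
  have hθ1 : θ < 1 := by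
    rw [Real.sqrt_lt' one_pos, one_pow, div_lt_one hNW]
    linarith
  have hθW : θ ^ 2 * W = -(((N : ℝ) - 2) / 2 * G / N) := by
    rw [Real.sq_sqrt hq.le]
    field_simp
  refine ⟨θ, ⟨hθ, hθ1⟩, ?_, ?_, ?_⟩
  · rw [hPoh θ hθ, hθW]
    field_simp
    ring
  · rw [hLa θ hθ, hθW]
    field_simp
    ring
  · have : θ ^ (N - 2) < 1 := pow_lt_one₀ hθ.le hθ1 (by omega)
    gcongr

end
end

section
/- Let $N \ge 3$, $\tilde m > 0$, and let $f : [0,\infty) \to \mathbb{R}$ be continuous with $f(0)=0$, satisfying $\lim_{t \to 0^+} f(t) = 0$ and $\limsup_{t \to \infty} f(t^2)/t^p < \infty$ for some $0 < p < 4/(N-2)$; set $F(t) = \int_0^t f(s)\,ds$. Then there exists $d > 0$ such that for every compactly supported continuously differentiable $u : \mathbb{R}^N \to \mathbb{C}$ with $\int_{\mathbb{R}^N} \big( |\nabla u|^2 + \tilde m |u|^2 \big)\,dy \le d^2$ one has $\tfrac12 \int_{\mathbb{R}^N} \big( |\nabla u|^2 + \tilde m |u|^2 \big)\,dy - \int_{\mathbb{R}^N}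 F(|u|^2)\,dy \ge \tfrac18 \int_{\mathbb{R}^N} \big( |\nabla u|^2 + \tilde m |u|^2 \big)\,dy$. -/
open MeasureTheory Filter

noncomputable section

/-- A continuous function vanishing at `0` and of growth order at most `r` at infinity is bounded
above by `ε + K t ^ r`. -/
lemma exists_le_add_mul_rpow {f : ℝ → ℝ} (hfc : ContinuousOn f (Set.Ici 0)) (hf0 : f 0 = 0)
    {ε p r C : ℝ} (hε : 0 < ε) (hr : 0 ≤ r) (hpr : p ≤ 2 * r)
    (hC : ∀ᶠ t in atTop, f (t ^ 2) / t ^ p ≤ C) :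
    ∃ K : ℝ, 0 ≤ K ∧ ∀ t : ℝ, 0 ≤ t → f t ≤ ε + K * t ^ r := by
  obtain ⟨δ, hδ, hδf⟩ := Metric.continuousWithinAt_iff.1 (hfc 0 (Set.self_mem_Ici)) ε hε
  obtain ⟨T, hT⟩ := eventually_atTop.1 hC
  obtain ⟨M, hM⟩ := (isCompact_Icc (a := 0) (b := (max T 1) ^ 2)).exists_bound_of_continuousOn
    (hfc.mono Set.Icc_subset_Ici_self)
  have hM0 : 0 ≤ M := (norm_nonneg _).trans (hM 0 ⟨le_rfl, by positivity⟩)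
  have hδr : 0 < δ ^ r := Real.rpow_pos_of_pos hδ r
  refine ⟨M / δ ^ r + |C|, by positivity, fun t ht ↦ ?_⟩
  have htr : 0 ≤ t ^ r := Real.rpow_nonneg ht r
  have h₁ : 0 ≤ M / δ ^ r * t ^ r := by positivity
  have h₂ : 0 ≤ |C| * t ^ r := by positivity
  rcases lt_or_ge t δ with htδ | htδ
  · have h := hδf (Set.mem_Ici.2 ht) (by simpa [abs_of_nonneg ht] using htδ)
    rw [hf0, dist_zero_right, Real.norm_eq_abs] at h
    nlinarith [le_abs_self (f t)]
  rcases le_or_gt t ((max T 1) ^ 2) with htT | htT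
  · have h₃ : M ≤ M / δ ^ r * t ^ r := by
      rw [div_mul_eq_mul_div, le_div_iff₀ hδr]
      gcongr
    have h := (le_abs_self _).trans (hM t ⟨ht, htT⟩)
    nlinarith
  · have hs : max T 1 < √t := Real.lt_sqrt_of_sq_lt htT
    have hs1 : 1 ≤ √t := (le_max_right T 1).trans hs.le
    have h := hT (√t) ((le_max_left T 1).trans hs.le)
    rw [Real.sq_sqrt ht, div_le_iff₀ (by positivity)] at h
    have h₃ : (√t) ^ p ≤ t ^ r := by
      calc (√t) ^ p ≤ (√t) ^ (2 * r) := Real.rpow_le_rpow_of_exponent_le hs1 hpr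
        _ = t ^ r := by
          rw [Real.rpow_mul (Real.sqrt_nonneg t), Real.rpow_two, Real.sq_sqrt ht]
    have h₄ : C * (√t) ^ p ≤ |C| * t ^ r := by
      gcongr
      exact le_abs_self C
    nlinarith

lemma Fprim_le {f : ℝ → ℝ} (hfc : ContinuousOn f (Set.Ici 0)) {ε K r : ℝ} (hr : 0 ≤ r)
    (hK : 0 ≤ K) (hf : ∀ t : ℝ, 0 ≤ t → f t ≤ ε + K * t ^ r) {s : ℝ} (hs : 0 ≤ s) :
    Fprim f s ≤ ε * s + K * s ^ (1 + r) := by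
  have hint : IntervalIntegrable f volume 0 s := by
    refine (hfc.mono ?_).intervalIntegrable
    rw [Set.uIcc_of_le hs]
    exact Set.Icc_subset_Ici_self
  calc Fprim f s ≤ ∫ _ in (0 : ℝ)..s, (ε + K * s ^ r) := by
        refine intervalIntegral.integral_mono_on hs hint intervalIntegrable_const fun t ht ↦ ?_
        refine (hf t ht.1).trans ?_
        gcongr
        · exact ht.1
        · exact ht.2
    _ = ε * s + K * s ^ (1 + r) := by
        rw [intervalIntegral.integral_const, Real.rpow_add_of_nonneg hs zero_le_one hr]
        simp
        ring

/-- The operator norm of the derivative is at most its Hilbert–Schmidt norm. -/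
lemma sq_norm_fderiv_le_gradSq {N : ℕ} (u : EuclideanSpace ℝ (Fin N) → ℂ)
    (y : EuclideanSpace ℝ (Fin N)) : ‖fderiv ℝ u y‖ ^ 2 ≤ gradSq u y := by
  have h0 : 0 ≤ gradSq u y := Finset.sum_nonneg fun j _ ↦ sq_nonneg _
  rw [← Real.le_sqrt (norm_nonneg _) h0]
  refine ContinuousLinearMap.opNorm_le_bound _ (Real.sqrt_nonneg _) fun v ↦ ?_
  have hv : fderiv ℝ u y v = ∑ j, v j • pd u j y := by
    conv_lhs => rw [← (EuclideanSpace.basisFun (Fin N) ℝ).sum_repr v]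
    simp [pd]
  rw [hv, EuclideanSpace.norm_eq, ← Real.sqrt_mul h0]
  refine Real.le_sqrt_of_sq_le ?_
  calc ‖∑ j, v j • pd u j y‖ ^ 2 ≤ (∑ j, ‖pd u j y‖ * ‖v j‖) ^ 2 := by
        gcongr
        refine (norm_sum_le _ _).trans_eq (Finset.sum_congr rfl fun j _ ↦ ?_)
        rw [norm_smul, mul_comm]
    _ ≤ gradSq u y * ∑ j, ‖v j‖ ^ 2 := Finset.sum_mul_sq_le_sq_mul_sq _ _ _

lemma hasCompactSupport_pd {N : ℕ} {u : EuclideanSpace ℝ (Fin N) → ℂ}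
    (hu : HasCompactSupport u) (j : Fin N) : HasCompactSupport (pd u j) :=
  (hu.fderiv (𝕜 := ℝ)).comp_left
    (g := fun L : EuclideanSpace ℝ (Fin N) →L[ℝ] ℂ ↦ L (EuclideanSpace.single j (1 : ℝ))) rfl

lemma integrable_comp_of_hasCompactSupport {N : ℕ} {u : EuclideanSpace ℝ (Fin N) → ℂ}
    (hu : Continuous u) (h2u : HasCompactSupport u) {g : ℂ → ℝ} (hg : Continuous g)
    (hg0 : g 0 = 0) : Integrable fun y ↦ g (u y) :=
  (hg.comp hu).integrable_of_hasCompactSupport (h2u.comp_left hg0)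

lemma integrable_gradSq {N : ℕ} {u : EuclideanSpace ℝ (Fin N) → ℂ} (hu : ContDiff ℝ 1 u)
    (h2u : HasCompactSupport u) : Integrable (gradSq u) := by
  refine integrable_finsetSum _ fun j _ ↦ ?_
  have hpd : Continuous (pd u j) := (hu.continuous_fderiv one_ne_zero).clm_apply continuous_const
  exact integrable_comp_of_hasCompactSupport hpd (hasCompactSupport_pd h2u j)
    (g := fun z ↦ ‖z‖ ^ 2) (by fun_prop) (by simp)

/-- The Sobolev inequality at the critical exponent `q = 2 (1 + r)`, where `r = 2 / (N - 2)`. -/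
lemma exists_integral_rpow_le_gradSq {N : ℕ} (hN : 3 ≤ N) {r : ℝ} (hr : r = 2 / ((N : ℝ) - 2)) :
    ∃ S : ℝ, 0 ≤ S ∧ ∀ u : EuclideanSpace ℝ (Fin N) → ℂ, ContDiff ℝ 1 u → HasCompactSupport u →
      ∫ y, (‖u y‖ ^ 2) ^ (1 + r) ≤ S * (∫ y, gradSq u y) ^ (1 + r) := by
  have hN' : (3 : ℝ) ≤ N := by exact_mod_cast hN
  have hN2 : (0 : ℝ) < N - 2 := by linarith
  have hr0 : 0 < r := by rw [hr]; positivity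
  obtain ⟨C, hC⟩ : ∃ C : NNReal, C = eLpNormLESNormFDerivOfEqInnerConst
    (volume : Measure (EuclideanSpace ℝ (Fin N))) (2 : NNReal) := ⟨_, rfl⟩
  refine ⟨((C : ℝ) ^ 2) ^ (1 + r), by positivity, fun u hu h2u ↦ ?_⟩
  let q : NNReal := ⟨2 * (1 + r), by positivity⟩
  have hq : (q : ℝ) = 2 * (1 + r) := rfl
  have hq0 : q ≠ 0 := by
    rw [← NNReal.coe_ne_zero, hq]; positivity
  have hsob := eLpNorm_le_eLpNorm_fderiv_of_eq_inner
    (volume : Measure (EuclideanSpace ℝ (Fin N))) hu h2u (p := 2) (p' := q) one_le_two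
    (by rw [finrank_euclideanSpace_fin]; lia)
    (by
      rw [finrank_euclideanSpace_fin, hq, hr]
      push_cast
      field_simp
      ring)
  have hDu := hu.continuous_fderiv one_ne_zero
  have hmem : MemLp u q volume := hu.continuous.memLp_of_hasCompactSupport h2u
  have hmemD : MemLp (fderiv ℝ u) (2 : NNReal) volume :=
    hDu.memLp_of_hasCompactSupport (h2u.fderiv (𝕜 := ℝ))
  rw [← hC, hmem.eLpNorm_eq_integral_rpow_norm (by exact_mod_cast hq0) ENNReal.coe_ne_top,
    hmemD.eLpNorm_eq_integral_rpow_norm (by norm_num) ENNReal.coe_ne_top,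
    ← ENNReal.ofReal_coe_nnreal (p := C), ← ENNReal.ofReal_mul (NNReal.coe_nonneg _),
    ENNReal.ofReal_le_ofReal_iff (by positivity)] at hsob
  simp only [ENNReal.coe_toReal, NNReal.coe_ofNat, hq, Real.rpow_two] at hsob
  set A := ∫ y, ‖u y‖ ^ (2 * (1 + r))
  set B := ∫ y, ‖fderiv ℝ u y‖ ^ 2
  have hA : 0 ≤ A := by positivity
  have hB : 0 ≤ B := by positivity
  have hBG : B ≤ ∫ y, gradSq u y := by
    refine integral_mono_of_nonneg (Eventually.of_forall fun y ↦ by positivity)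
      (integrable_gradSq hu h2u) (Eventually.of_forall (sq_norm_fderiv_le_gradSq u))
  calc ∫ y, (‖u y‖ ^ 2) ^ (1 + r) = A := by
        refine integral_congr_ae (Eventually.of_forall fun y ↦ ?_)
        simp only
        rw [Real.rpow_mul (norm_nonneg _), Real.rpow_two]
    _ = (A ^ (2 * (1 + r))⁻¹) ^ (2 * (1 + r)) := by
        rw [Real.rpow_inv_rpow hA (by positivity)]
    _ ≤ (C * B ^ (2 : ℝ)⁻¹) ^ (2 * (1 + r)) := by gcongr
    _ = ((C : ℝ) ^ 2) ^ (1 + r) * B ^ (1 + r) := by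
        rw [Real.rpow_mul (by positivity), Real.rpow_two, mul_pow, ← Real.rpow_two (B ^ _),
          Real.rpow_inv_rpow hB two_ne_zero, Real.mul_rpow (by positivity) hB]
    _ ≤ ((C : ℝ) ^ 2) ^ (1 + r) * (∫ y, gradSq u y) ^ (1 + r) := by gcongr

theorem stmt16 {N : ℕ} (hN : 3 ≤ N) (m : ℝ) (hm : 0 < m)
    (f : ℝ → ℝ) (hfc : ContinuousOn f (Set.Ici 0)) (hf0 : f 0 = 0)
    (hf1 : Filter.Tendsto f (nhdsWithin 0 (Set.Ioi 0)) (nhds 0))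
    (hf2 : ∃ p : ℝ, 0 < p ∧ p < 4 / ((N : ℝ) - 2) ∧
      ∃ C : ℝ, ∀ᶠ t in Filter.atTop, f (t ^ 2) / t ^ p ≤ C) :
    ∃ d : ℝ, 0 < d ∧
      ∀ u : EuclideanSpace ℝ (Fin N) → ℂ, ContDiff ℝ 1 u → HasCompactSupport u →
        (∫ y, (gradSq u y + m * ‖u y‖ ^ 2)) ≤ d ^ 2 →
        (1/8) * (∫ y, (gradSq u y + m * ‖u y‖ ^ 2)) ≤
          (1/2) * (∫ y, (gradSq u y + m * ‖u y‖ ^ 2)) - ∫ y, Fprim f (‖u y‖ ^ 2) := by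
  obtain ⟨p, -, hp, C, hC⟩ := hf2
  have hN' : (3 : ℝ) ≤ N := by exact_mod_cast hN
  have hN2 : (0 : ℝ) < N - 2 := by linarith
  obtain ⟨r, hr⟩ : ∃ r : ℝ, r = 2 / ((N : ℝ) - 2) := ⟨_, rfl⟩
  have hr0 : 0 < r := by rw [hr]; positivity
  have hpr : p ≤ 2 * r := by
    rw [hr, ← mul_div_assoc]
    norm_num
    exact hp.le
  obtain ⟨K, hK0, hK⟩ := exists_le_add_mul_rpow hfc hf0 (show 0 < m / 4 by positivity) hr0.le hpr hC
  obtain ⟨S, hS0, hS⟩ := exists_integral_rpow_le_gradSq hN hr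
  obtain ⟨η, hη, hKSη⟩ : ∃ η : ℝ, 0 < η ∧ K * S * η ≤ 1 / 8 := by
    refine ⟨1 / (8 * (K * S + 1)), by positivity, ?_⟩
    rw [mul_one_div, div_le_div_iff₀ (by positivity) (by norm_num)]
    linarith
  refine ⟨√(η ^ r⁻¹), by positivity, fun u hu h2u hI ↦ ?_⟩
  rw [Real.sq_sqrt (by positivity)] at hI
  have hG := integrable_gradSq hu h2u
  have hU : Integrable fun y ↦ ‖u y‖ ^ 2 :=
    integrable_comp_of_hasCompactSupport hu.continuous h2u (g := fun z ↦ ‖z‖ ^ 2)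
      (by fun_prop) (by simp)
  have hQ : Integrable fun y ↦ (‖u y‖ ^ 2) ^ (1 + r) :=
    integrable_comp_of_hasCompactSupport hu.continuous h2u (g := fun z ↦ (‖z‖ ^ 2) ^ (1 + r))
      ((continuous_norm.pow 2).rpow_const fun _ ↦ .inr (by positivity))
      (by simp [Real.zero_rpow (show 1 + r ≠ 0 by positivity)])
  have hI_eq : ∫ y, (gradSq u y + m * ‖u y‖ ^ 2) = (∫ y, gradSq u y) + m * ∫ y, ‖u y‖ ^ 2 := by
    rw [integral_add hG (hU.const_mul m), integral_const_mul]
  have hG0 : 0 ≤ ∫ y, gradSq u y :=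
    integral_nonneg fun y ↦ Finset.sum_nonneg fun j _ ↦ sq_nonneg _
  have hU0 : 0 ≤ m * ∫ y, ‖u y‖ ^ 2 := by positivity
  set I := ∫ y, (gradSq u y + m * ‖u y‖ ^ 2)
  have hI0 : 0 ≤ I := by linarith
  suffices h : ∫ y, Fprim f (‖u y‖ ^ 2) ≤ 3 / 8 * I by linarith
  by_cases hF : Integrable fun y ↦ Fprim f (‖u y‖ ^ 2)
  swap
  · rw [integral_undef hF]
    positivity
  have hIr : I ^ r ≤ η := by
    calc I ^ r ≤ (η ^ r⁻¹) ^ r := by gcongr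
      _ = η := Real.rpow_inv_rpow hη.le hr0.ne'
  have hQI : K * ∫ y, (‖u y‖ ^ 2) ^ (1 + r) ≤ 1 / 8 * I := by
    calc K * ∫ y, (‖u y‖ ^ 2) ^ (1 + r) ≤ K * (S * (∫ y, gradSq u y) ^ (1 + r)) := by
          gcongr
          exact hS u hu h2u
      _ ≤ K * (S * I ^ (1 + r)) := by
          gcongr
          linarith
      _ = K * S * I ^ r * I := by
          rw [Real.rpow_add_of_nonneg hI0 zero_le_one hr0.le, Real.rpow_one]
          ring
      _ ≤ K * S * η * I := by gcongr
      _ ≤ 1 / 8 * I := by gcongr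
  calc ∫ y, Fprim f (‖u y‖ ^ 2)
      ≤ ∫ y, (m / 4 * ‖u y‖ ^ 2 + K * (‖u y‖ ^ 2) ^ (1 + r)) :=
        integral_mono hF ((hU.const_mul _).add (hQ.const_mul K)) fun y ↦
          Fprim_le hfc hr0.le hK0 hK (sq_nonneg _)
    _ = 1 / 4 * (m * ∫ y, ‖u y‖ ^ 2) + K * ∫ y, (‖u y‖ ^ 2) ^ (1 + r) := by
        rw [integral_add (hU.const_mul _) (hQ.const_mul K), integral_const_mul,
          integral_const_mul]
        ring
    _ ≤ 3 / 8 * I := by linarith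

end
end
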